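/- Let n be a finite index type, N ≥ 1, a_1, …, a_N ∈ ℝ^n, let p0 : ℝ → ℝ be twice differentiable and strictly positive with W(u) = p0'(u)/p0(u), and consider functions of two real variables (t̂, t): μ(t) ∈ ℝ^n and Σ(t) ∈ Matrix n n ℝ differentiable at t₀ with Σ(t) symmetric and Σ(t₀) invertible, and P̂(t̂) ∈ Matrix n n ℝ and μ̂(t̂) ∈ ℝ^n differentiable at t̂₀. Write z_j = P̂(t̂₀).mulVec a_j + μ̂(t̂₀), d_j = z_j − μ(t₀), q_j = d_j ⬝ᵥ Σ(t₀)⁻¹.mulVec d_j, Σ' = dΣ/dt at t₀, μ' = dμ/dt at t₀, Σ^{(t)} = −Σ⁻¹Σ'Σ⁻¹, and v_j = (dP̂/dt̂ at t̂₀).mulVec a_j + dμ̂/dt̂ at t̂₀. Then the mixed second partial derivative ∂²/∂t̂∂t at (t̂₀,t₀) of ℓ(t̂,t) = −(N/2) log |det Σ(t)| + Σ_j log p0((P̂(t̂).mulVec a_j + μ̂(t̂) − μ(t)) ⬝ᵥ Σ(t)⁻¹.mulVec (P̂(t̂).mulVec a_j + μ̂(t̂) − μ(t))) equals 2 Σ_{j=1}^N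 { W(q_j)·( v_j ⬝ᵥ Σ^{(t)}.mulVec d_j − μ' ⬝ᵥ Σ⁻¹.mulVec v_j ) + W'(q_j)·( v_j ⬝ᵥ Σ⁻¹.mulVec d_j )·( d_j ⬝ᵥ Σ^{(t)}.mulVec d_j − 2 μ' ⬝ᵥ Σ⁻¹.mulVec d_j ) }. -/

import Mathlib

open Matrix

theorem HasDerivAt.dotProduct {n : Type*} [Fintype n] {u v : ℝ → n → ℝ} {u' v' : n → ℝ} {t : ℝ}
    (hu : HasDerivAt u u' t) (hv : HasDerivAt v v' t) :
    HasDerivAt (fun s => u s ⬝ᵥ v s) (u' ⬝ᵥ v t + u t ⬝ᵥ v') t := by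
  simp only [_root_.dotProduct, ← Finset.sum_add_distrib]
  exact HasDerivAt.fun_sum fun i _ => (hasDerivAt_pi.1 hu i).mul (hasDerivAt_pi.1 hv i)

theorem HasDerivAt.matrix_row {m n : Type*} [Fintype m] [Fintype n] {A : ℝ → Matrix m n ℝ}
    {A' : Matrix m n ℝ} {t : ℝ} (hA : HasDerivAt A A' t) (i : m) :
    HasDerivAt (fun s => A s i) (A' i) t :=
  (hasDerivAt_pi (φ := A)).1 hA i

theorem HasDerivAt.matrix_mulVec {m n : Type*} [Fintype m] [Fintype n] {A : ℝ → Matrix m n ℝ}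
    {A' : Matrix m n ℝ} {v : ℝ → n → ℝ} {v' : n → ℝ} {t : ℝ}
    (hA : HasDerivAt A A' t) (hv : HasDerivAt v v' t) :
    HasDerivAt (fun s => A s *ᵥ v s) (A' *ᵥ v t + A t *ᵥ v') t :=
  hasDerivAt_pi.2 fun i => (hA.matrix_row i).dotProduct hv

theorem HasDerivAt.differentiableAt_matrix_det {n : Type*} [Fintype n] [DecidableEq n]
    {A : ℝ → Matrix n n ℝ} {A' : Matrix n n ℝ} {t : ℝ} (hA : HasDerivAt A A' t) :
    DifferentiableAt ℝ (fun s => (A s).det) t := by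
  have h (i j : n) : DifferentiableAt ℝ (fun s => A s i j) t :=
    (hasDerivAt_pi.1 (hA.matrix_row i) j).differentiableAt
  simp only [Matrix.det_apply']
  fun_prop

section

attribute [local instance] Matrix.linftyOpNormedRing Matrix.linftyOpNormedAlgebra

theorem HasDerivAt.matrix_inv {n : Type*} [Fintype n] [DecidableEq n]
    {A : ℝ → Matrix n n ℝ} {A' : Matrix n n ℝ} {t : ℝ} (hA : HasDerivAt A A' t)
    (h : IsUnit (A t).det) :
    HasDerivAt (fun s => (A s)⁻¹) (-((A t)⁻¹ * A' * (A t)⁻¹)) t := by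
  obtain ⟨x, hx⟩ := (Matrix.isUnit_iff_isUnit_det _).2 h
  have hinv := hasFDerivAt_ringInverse (𝕜 := ℝ) x
  rw [hx] at hinv
  simpa [Function.comp_def, ← Matrix.nonsing_inv_eq_ringInverse, hx] using!
    hinv.comp_hasDerivAt t hA

end

theorem Matrix.IsSymm.dotProduct_mulVec_comm {n : Type*} [Fintype n] {A : Matrix n n ℝ}
    (hA : A.IsSymm) (x y : n → ℝ) : x ⬝ᵥ A *ᵥ y = y ⬝ᵥ A *ᵥ x := by
  rw [dotProduct_mulVec, ← mulVec_transpose, hA.eq, dotProduct_comm]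

attribute [local instance] Matrix.normedAddCommGroup Matrix.normedSpace

/-- The mixed sample-space derivative `U'_{(k)ii'} = ∂²ℓ(θ; θ̂, a)/∂θ̂ ∂θ` of Appendix B,
where the data are reconstructed from the ancillary statistic as `z_j = P̂(t̂) a_j + μ̂(t̂)`
and `ℓ(t̂,t) = −(N/2) log |Σ(t)| + Σ_j log p0(d_jᵀ Σ(t)⁻¹ d_j)`. -/
theorem stmt_10 {n : Type*} [Fintype n] [DecidableEq n] (N : ℕ) (hN : 1 ≤ N)
    (a : Fin N → n → ℝ) (p0 : ℝ → ℝ)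
    (hp0 : Differentiable ℝ p0) (hp0' : Differentiable ℝ (deriv p0))
    (hp0pos : ∀ u, 0 < p0 u)
    (W : ℝ → ℝ) (hW : W = fun u => deriv p0 u / p0 u)
    (μ : ℝ → n → ℝ) (S : ℝ → Matrix n n ℝ) (t₀ : ℝ)
    (S' : Matrix n n ℝ) (μ' : n → ℝ)
    (hS : HasDerivAt S S' t₀) (hμ : HasDerivAt μ μ' t₀)
    (hsym : ∀ t, (S t).IsSymm) (hinv : IsUnit (S t₀).det)
    (Phat : ℝ → Matrix n n ℝ) (muhat : ℝ → n → ℝ) (th₀ : ℝ)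
    (Phat' : Matrix n n ℝ) (muhat' : n → ℝ)
    (hPhat : HasDerivAt Phat Phat' th₀) (hmuhat : HasDerivAt muhat muhat' th₀)
    (z d : Fin N → n → ℝ) (q : Fin N → ℝ)
    (hz : ∀ j, z j = (Phat th₀).mulVec (a j) + muhat th₀)
    (hd : ∀ j, d j = z j - μ t₀)
    (hq : ∀ j, q j = d j ⬝ᵥ (S t₀)⁻¹.mulVec (d j))
    (Sinvt : Matrix n n ℝ) (hSinvt : Sinvt = -((S t₀)⁻¹ * S' * (S t₀)⁻¹))
    (v : Fin N → n → ℝ) (hv : ∀ j, v j = Phat'.mulVec (a j) + muhat') :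
    deriv (fun th => deriv
        (fun t => -(N / 2 : ℝ) * Real.log |((S t).det)| +
          ∑ j, Real.log
            (p0 (((Phat th).mulVec (a j) + muhat th - μ t) ⬝ᵥ
              (S t)⁻¹.mulVec ((Phat th).mulVec (a j) + muhat th - μ t)))) t₀) th₀
      = 2 * ∑ j,
          (W (q j) * (v j ⬝ᵥ Sinvt.mulVec (d j) - μ' ⬝ᵥ (S t₀)⁻¹.mulVec (v j))
            + deriv W (q j) * (v j ⬝ᵥ (S t₀)⁻¹.mulVec (d j)) *
              (d j ⬝ᵥ Sinvt.mulVec (d j) - 2 * (μ' ⬝ᵥ (S t₀)⁻¹.mulVec (d j)))) := by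
  have hW_deriv (u : ℝ) : HasDerivAt W (deriv W u) u := by
    subst hW
    exact ((hp0' u).div (hp0 u) (hp0pos u).ne').hasDerivAt
  have hlog (u : ℝ) : HasDerivAt (fun x => Real.log (p0 x)) (W u) u := by
    simpa [hW] using (hp0 u).hasDerivAt.log (hp0pos u).ne'
  have hB := hS.matrix_inv hinv
  rw [← hSinvt] at hB
  set B := (S t₀)⁻¹ with hBdef
  have hBsymm : B.IsSymm := by
    rw [Matrix.IsSymm, hBdef, Matrix.transpose_nonsing_inv, (hsym t₀).eq]
  have hS'symm : S'.IsSymm := by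
    have hT : HasDerivAt (fun t => (S t)ᵀ) S'ᵀ t₀ :=
      hasDerivAt_pi.2 fun i => hasDerivAt_pi.2 fun j => hasDerivAt_pi.1 (hS.matrix_row j) i
    simp only [(hsym _).eq] at hT
    exact hT.unique hS
  have hCsymm : Sinvt.IsSymm := by
    rw [Matrix.IsSymm, hSinvt, Matrix.transpose_neg, Matrix.transpose_mul, Matrix.transpose_mul,
      hBsymm.eq, hS'symm.eq, Matrix.mul_assoc]
  obtain ⟨D, hD⟩ : ∃ D, HasDerivAt (fun t => -(N / 2 : ℝ) * Real.log |(S t).det|) D t₀ := by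
    simp only [Real.log_abs]
    exact ⟨_, ((hS.differentiableAt_matrix_det.log hinv.ne_zero).const_mul _).hasDerivAt⟩
  let e (j : Fin N) (th : ℝ) : n → ℝ := Phat th *ᵥ a j + muhat th - μ t₀
  have hinner (th : ℝ) : deriv
        (fun t => -(N / 2 : ℝ) * Real.log |((S t).det)| +
          ∑ j, Real.log
            (p0 (((Phat th).mulVec (a j) + muhat th - μ t) ⬝ᵥ
              (S t)⁻¹.mulVec ((Phat th).mulVec (a j) + muhat th - μ t)))) t₀ =
      D + ∑ j, W (e j th ⬝ᵥ B *ᵥ e j th) *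
        (e j th ⬝ᵥ Sinvt *ᵥ e j th - 2 * (μ' ⬝ᵥ B *ᵥ e j th)) := by
    refine (hD.add (HasDerivAt.fun_sum fun j _ => ?_)).deriv
    have hsub : HasDerivAt (fun t => Phat th *ᵥ a j + muhat th - μ t) (-μ') t₀ :=
      hμ.const_sub _
    have hcomp := (hlog (e j th ⬝ᵥ B *ᵥ e j th)).comp t₀
      (hsub.dotProduct (hB.matrix_mulVec hsub))
    refine hcomp.congr_deriv ?_
    change _ * (-μ' ⬝ᵥ B *ᵥ e j th + e j th ⬝ᵥ (Sinvt *ᵥ e j th + B *ᵥ (-μ'))) = _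
    rw [dotProduct_add, hBsymm.dotProduct_mulVec_comm (e j th) (-μ'), neg_dotProduct]
    ring
  simp only [hinner]
  have hed (j : Fin N) : e j th₀ = d j := by simp only [e, hd, hz]
  have he_deriv (j : Fin N) : HasDerivAt (e j) (v j) th₀ := by
    have h := ((hPhat.matrix_mulVec (hasDerivAt_const th₀ (a j))).add hmuhat).sub_const (μ t₀)
    rw [mulVec_zero, add_zero, ← hv] at h
    exact h
  have hquad {A : Matrix n n ℝ} (hA : A.IsSymm) (j : Fin N) :
      HasDerivAt (fun th => e j th ⬝ᵥ A *ᵥ e j th) (2 * (v j ⬝ᵥ A *ᵥ d j)) th₀ := by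
    refine ((he_deriv j).dotProduct
      ((hasDerivAt_const th₀ A).matrix_mulVec (he_deriv j))).congr_deriv ?_
    rw [zero_mulVec, zero_add, hed, hA.dotProduct_mulVec_comm (d j)]
    ring
  have hlin (j : Fin N) : HasDerivAt (fun th => μ' ⬝ᵥ B *ᵥ e j th) (μ' ⬝ᵥ B *ᵥ v j) th₀ := by
    refine ((hasDerivAt_const th₀ μ').dotProduct
      ((hasDerivAt_const th₀ B).matrix_mulVec (he_deriv j))).congr_deriv ?_
    simp
  rw [Finset.mul_sum]
  refine ((HasDerivAt.fun_sum fun j _ => ?_).const_add D).deriv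
  have hWcomp : HasDerivAt (fun th => W (e j th ⬝ᵥ B *ᵥ e j th))
      (deriv W (q j) * (2 * (v j ⬝ᵥ B *ᵥ d j))) th₀ := by
    have h := (hW_deriv (e j th₀ ⬝ᵥ B *ᵥ e j th₀)).comp th₀ (hquad hBsymm j)
    rwa [hed, ← hq] at h
  refine (hWcomp.mul ((hquad hCsymm j).sub ((hlin j).const_mul 2))).congr_deriv ?_
  simp only [Pi.sub_apply]
  rw [hed, ← hq]
  ring
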